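/- (Strong local nondeterminism in the space variable.) Fix t₀ > 0 and define N_{t₀}(ξ) = (1/(4|ξ|²)) ∫_ℝ |(e^{−it₀τ} − e^{it₀|ξ|})/(τ + |ξ|) − (e^{−it₀τ} − e^{−it₀|ξ|})/(τ − |ξ|)|² |τ|^{1−2H} dτ for ξ ≠ 0, so that ∫_ℝ 𝒢_{t₀,x}(τ, ξ) · conj(𝒢_{t₀,y}(τ, ξ)) |τ|^{1−2H} dτ = e^{−i⟨x − y, ξ⟩} N_{t₀}(ξ). Then for every 0 < M < ∞ there exists a constant C > 0 such that for every integer n ≥ 1, all x, x¹, …, xⁿ ∈ ℝ^N with |x| ≤ M and |x^j| ≤ M for all j, and all real numbers a₁, …, aₙ, one has ∫_ℝ ∫_{ℝ^N} |𝒢_{t₀,x}(τ, ξ) − Σ_{j=1}^n a_j 𝒢_{t₀,x^j}(τ, ξ)|² |τ|^{1−2H} h_β(ξ) dξ dτ ≥ C min_{1≤j≤n} |x − x^j|^{2α}. -/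

import Mathlib

open MeasureTheory Set
open scoped ENNReal

/-- The time–space Fourier transform `𝒢_{t,x}(τ, ξ)` of the wave kernel
`g_{t,x}(s, y) = G(t − s, x − y) 1_{[0,t]}(s)`. -/
noncomputable def Gker (N : ℕ) (t : ℝ) (x : EuclideanSpace ℝ (Fin N)) (τ : ℝ)
    (ξ : EuclideanSpace ℝ (Fin N)) : ℂ :=
  (Complex.exp (-Complex.I * ((inner ℝ x ξ : ℝ) : ℂ)) / (2 * (‖ξ‖ : ℂ))) *
    ((Complex.exp (-Complex.I * (t : ℂ) * (τ : ℂ)) -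
        Complex.exp (Complex.I * (t : ℂ) * (‖ξ‖ : ℂ))) / ((τ : ℂ) + (‖ξ‖ : ℂ)) -
      (Complex.exp (-Complex.I * (t : ℂ) * (τ : ℂ)) -
        Complex.exp (-Complex.I * (t : ℂ) * (‖ξ‖ : ℂ))) / ((τ : ℂ) - (‖ξ‖ : ℂ)))

/-- The spectral integral `∫_ℝ ∫_{ℝ^N} |f(τ,ξ)|² |τ|^{1−2H} h_β(ξ) dξ dτ`, which (up to a
positive constant) gives the variance of the corresponding linear functional of the solution. -/
noncomputable def specInt (N : ℕ) (H : ℝ) (hfun : EuclideanSpace ℝ (Fin N) → ℝ)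
    (f : ℝ → EuclideanSpace ℝ (Fin N) → ℂ) : ℝ≥0∞ :=
  ∫⁻ τ : ℝ, ∫⁻ ξ : EuclideanSpace ℝ (Fin N),
    ENNReal.ofReal (‖f τ ξ‖ ^ 2 * |τ| ^ (1 - 2 * H) * hfun ξ)

/-- The spectral density `N_{t₀}(ξ)` of the stationary Gaussian field `x ↦ u₁(t₀, x)`,
relative to `h_β`. -/
noncomputable def Ndens (H t₀ : ℝ) (r : ℝ) : ℝ :=
  (1 / (4 * r ^ 2)) *
    ∫ τ : ℝ,
      ‖((Complex.exp (-Complex.I * (t₀ : ℂ) * (τ : ℂ)) -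
              Complex.exp (Complex.I * (t₀ : ℂ) * (r : ℂ))) / ((τ : ℂ) + (r : ℂ)) -
            (Complex.exp (-Complex.I * (t₀ : ℂ) * (τ : ℂ)) -
              Complex.exp (-Complex.I * (t₀ : ℂ) * (r : ℂ))) / ((τ : ℂ) - (r : ℂ)))‖ ^ 2 *
        |τ| ^ (1 - 2 * H)



noncomputable def Kk (t r τ : ℝ) : ℂ :=
    ((Complex.exp (-Complex.I * (t : ℂ) * (τ : ℂ)) -
        Complex.exp (Complex.I * (t : ℂ) * (r : ℂ))) / ((τ : ℂ) + (r : ℂ)) -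
      (Complex.exp (-Complex.I * (t : ℂ) * (τ : ℂ)) -
        Complex.exp (-Complex.I * (t : ℂ) * (r : ℂ))) / ((τ : ℂ) - (r : ℂ)))

noncomputable def kk (t r s : ℝ) : ℂ :=
  Complex.exp (Complex.I * ((t - s) * r : ℝ)) - Complex.exp (-Complex.I * ((t - s) * r : ℝ))

lemma kk_cont (t r : ℝ) : Continuous (kk t r) := by
  unfold kk; fun_prop

lemma Kk_eq (t r τ : ℝ) (h1 : τ + r ≠ 0) (h2 : τ - r ≠ 0) :
    Kk t r τ = -Complex.I * ∫ s in (0:ℝ)..t, Complex.exp (-Complex.I * (s * τ : ℝ)) * kk t r s := by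
  have e : ∀ s : ℝ, Complex.exp (-Complex.I * (s * τ : ℝ)) * kk t r s =
      Complex.exp (Complex.I * t * r) * Complex.exp ((-Complex.I * (τ + r)) * s) -
      Complex.exp (-Complex.I * t * r) * Complex.exp ((-Complex.I * (τ - r)) * s) := by
    intro s
    unfold kk
    rw [mul_sub, ← Complex.exp_add, ← Complex.exp_add, ← Complex.exp_add, ← Complex.exp_add]
    congr 2 <;> push_cast <;> ring
  have h1' : (τ + r : ℂ) ≠ 0 := by exact_mod_cast h1
  have h2' : (τ - r : ℂ) ≠ 0 := by exact_mod_cast h2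
  simp_rw [e]
  rw [intervalIntegral.integral_sub, intervalIntegral.integral_const_mul,
    intervalIntegral.integral_const_mul, integral_exp_mul_complex, integral_exp_mul_complex]
  · unfold Kk
    have a1 : Complex.exp (-Complex.I * t * τ) =
      Complex.exp (Complex.I * t * r) * Complex.exp ((-Complex.I * (τ + r)) * t) := by
      rw [← Complex.exp_add]; congr 1; ring
    have a2 : Complex.exp (-Complex.I * t * τ) =
      Complex.exp (-Complex.I * t * r) * Complex.exp ((-Complex.I * (τ - r)) * t) := by
      rw [← Complex.exp_add]; congr 1; ring
    nth_rewrite 1 [a1]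
    rw [a2]
    have := Complex.I_ne_zero
    simp only [Complex.ofReal_zero, mul_zero, Complex.exp_zero]
    field_simp
    ring
  · exact mul_ne_zero (by simp) h2'
  · exact mul_ne_zero (by simp) h1'
  · exact (by fun_prop : Continuous _).intervalIntegrable _ _
  · exact (by fun_prop : Continuous _).intervalIntegrable _ _

lemma Kk_diag (t r : ℝ) (h1 : r ≠ 0) :
    ∫ s in (0:ℝ)..t, Complex.exp (-Complex.I * (s * r : ℝ)) * kk t r s =
     (Real.sin (t * r) / r : ℝ) - t * Complex.exp (-Complex.I * (t * r : ℝ)) := by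
  have e : ∀ s : ℝ, Complex.exp (-Complex.I * (s * r : ℝ)) * kk t r s =
      Complex.exp (Complex.I * t * r) * Complex.exp ((-Complex.I * (2 * r)) * s) -
      Complex.exp (-Complex.I * (t * r : ℝ)) := by
    intro s
    unfold kk
    rw [mul_sub, ← Complex.exp_add, ← Complex.exp_add, ← Complex.exp_add]
    congr 2 <;> push_cast <;> ring
  have h1' : (r : ℂ) ≠ 0 := by exact_mod_cast h1
  simp_rw [e]
  rw [intervalIntegral.integral_sub, intervalIntegral.integral_const_mul,
     integral_exp_mul_complex, intervalIntegral.integral_const]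
  · have a1 : Complex.exp (Complex.I * t * r) * Complex.exp (-Complex.I * (2 * r) * t) =
      Complex.exp (-(t * r) * Complex.I) := by
      rw [← Complex.exp_add]; congr 1; ring
    push_cast
    rw [Complex.sin, mul_div_assoc', mul_sub, a1]
    have := Complex.I_ne_zero
    simp only [sub_zero, mul_zero, Complex.exp_zero, mul_one, Complex.real_smul]
    congr 1
    rw [show Complex.I * t * r = t * r * Complex.I by ring]
    field_simp
    rw [Complex.I_sq]; ring
  · exact mul_ne_zero (by simp) (by simpa using h1)
  · exact (by fun_prop : Continuous _).intervalIntegrable _ _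
  · exact (by fun_prop : Continuous _).intervalIntegrable _ _

lemma diag_lower (t r : ℝ) (ht : 0 < t) (hr : 0 < r) :
    t / 3 * min 1 (t * r) ≤ 
     ‖((Real.sin (t * r) / r : ℝ) - t * Complex.exp (-Complex.I * (t * r : ℝ)) : ℂ)‖ := by
  have hθ : 0 < t * r := by positivity
  rcases le_total (t * r) (Real.pi / 2) with h | h
  · refine le_trans ?_ (Complex.abs_im_le_norm _)
    have him : ((Real.sin (t * r) / r : ℝ) - t * Complex.exp (-Complex.I * (t * r : ℝ)) : ℂ).im
        = t * Real.sin (t * r) := by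
      rw [show -Complex.I * (t * r : ℝ) = ((-(t * r) : ℝ) : ℂ) * Complex.I by push_cast; ring,
        Complex.sub_im, Complex.ofReal_im, Complex.im_ofReal_mul]
      rw [Complex.exp_ofReal_mul_I_im, Real.sin_neg]; ring
    rw [him]
    have h3 := Real.mul_le_sin hθ.le h
    refine le_trans ?_ (le_abs_self _)
    have : (1:ℝ) / 3 ≤ 2 / Real.pi := by
      rw [div_le_div_iff₀ (by norm_num) Real.pi_pos]; linarith [Real.pi_le_four]
    calc t / 3 * min 1 (t * r) ≤ t / 3 * (t * r) := by gcongr; exact min_le_right _ _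
      _ = t * (1 / 3 * (t * r)) := by ring
      _ ≤ t * (2 / Real.pi * (t * r)) := by gcongr
      _ ≤ _ := by gcongr
  · rw [norm_sub_rev]
    refine le_trans ?_ (norm_sub_norm_le _ _)
    have hn : ‖(t * Complex.exp (-Complex.I * (t * r : ℝ)) : ℂ)‖ = t := by
      rw [show -Complex.I * (t * r : ℝ) = ((-(t * r) : ℝ) : ℂ) * Complex.I by push_cast; ring,
        norm_mul, Complex.norm_exp_ofReal_mul_I]
      simp [abs_of_pos ht]
    rw [hn, Complex.norm_real, Real.norm_eq_abs, abs_div, abs_of_pos hr]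
    have h1 : |Real.sin (t * r)| / r ≤ 1 / r := by gcongr; exact Real.abs_sin_le_one _
    have h2 : 1 / r ≤ t * (2 / 3) := by
      rw [div_le_iff₀ hr]; nlinarith [Real.pi_gt_three]
    have h4 : t / 3 * min 1 (t * r) ≤ t / 3 * 1 := by gcongr; exact min_le_left _ _
    linarith

lemma kk_bound (t r s : ℝ) (hr : 0 < r) (h0 : 0 ≤ s) (hs : s ≤ t) :
    ‖kk t r s‖ ≤ 2 * min 1 (t * r) := by
  have e1 : ∀ a : ℝ, ‖Complex.exp (Complex.I * a)‖ = 1 := fun a => by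
    rw [mul_comm, Complex.norm_exp_ofReal_mul_I]
  have e2 : ∀ a : ℝ, -Complex.I * (a:ℂ) = Complex.I * ((-a : ℝ) : ℂ) := fun a => by push_cast; ring
  rw [mul_min_of_nonneg _ _ (by norm_num), le_min_iff]
  unfold kk
  rw [e2]
  constructor
  · refine (norm_sub_le _ _).trans ?_
    rw [e1, e1]; norm_num
  · have h1 := Real.norm_exp_I_mul_ofReal_sub_one_le (x := (t - s) * r)
    have h2 := Real.norm_exp_I_mul_ofReal_sub_one_le (x := -((t - s) * r))
    have := norm_sub_le (Complex.exp (Complex.I * ((t - s) * r : ℝ)) - 1)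
      (Complex.exp (Complex.I * (-((t - s) * r) : ℝ)) - 1)
    rw [sub_sub_sub_cancel_right] at this
    rw [Real.norm_eq_abs] at h1 h2
    rw [abs_neg] at h2
    rw [abs_of_nonneg (by nlinarith)] at h1 h2
    nlinarith

lemma Kk_lower (t r τ : ℝ) (ht : 0 < t) (hr : 0 < r) (h1 : r < τ) (h2 : τ < r + 1 / (12 * t)) :
    t / 6 * min 1 (t * r) ≤ ‖Kk t r τ‖ := by
  rw [Kk_eq t r τ (by linarith) (by linarith), norm_mul, norm_neg, Complex.norm_I, one_mul]
  have hd := diag_lower t r ht hr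
  rw [← Kk_diag t r hr.ne'] at hd
  have hkc := kk_cont t r
  have hb : ‖(∫ s in (0:ℝ)..t, Complex.exp (-Complex.I * (s * τ : ℝ)) * kk t r s) -
      (∫ s in (0:ℝ)..t, Complex.exp (-Complex.I * (s * r : ℝ)) * kk t r s)‖ ≤
      (1 / 12 * (2 * min 1 (t * r))) * |t - 0| := by
    rw [← intervalIntegral.integral_sub]
    · apply intervalIntegral.norm_integral_le_of_norm_le_const
      intro s hs
      rw [Set.uIoc_of_le ht.le] at hs
      rw [← sub_mul, norm_mul]
      gcongr
      · have : Complex.exp (-Complex.I * (s * τ : ℝ)) - Complex.exp (-Complex.I * (s * r : ℝ)) =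
          Complex.exp ((-(s * r) : ℝ) * Complex.I) * (Complex.exp (Complex.I * (-(s * (τ - r)) : ℝ)) - 1) := by
          rw [mul_sub, ← Complex.exp_add, mul_one]
          congr 2 <;> push_cast <;> ring
        rw [this, norm_mul, Complex.norm_exp_ofReal_mul_I, one_mul]
        refine Real.norm_exp_I_mul_ofReal_sub_one_le.trans ?_
        rw [Real.norm_eq_abs, abs_neg, abs_of_nonneg (mul_nonneg hs.1.le (by linarith))]
        calc s * (τ - r) ≤ t * (1 / (12 * t)) := by
              apply mul_le_mul hs.2 (by linarith) (by linarith) ht.le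
          _ = 1 / 12 := by field_simp
      · exact kk_bound t r s hr hs.1.le hs.2
    · exact (by fun_prop : Continuous _).intervalIntegrable _ _
    · exact (by fun_prop : Continuous _).intervalIntegrable _ _
  rw [sub_zero, abs_of_pos ht] at hb
  rw [norm_sub_rev] at hb
  have := norm_sub_norm_le (∫ s in (0:ℝ)..t, Complex.exp (-Complex.I * (s * r : ℝ)) * kk t r s) (∫ s in (0:ℝ)..t, Complex.exp (-Complex.I * (s * τ : ℝ)) * kk t r s)
  linarith
open scoped SchwartzMap FourierTransform

lemma exists_bump (N : ℕ) : ∃ (g : 𝓢(EuclideanSpace ℝ (Fin N), ℂ))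
    (ψ : EuclideanSpace ℝ (Fin N) → ℂ), ψ 0 = 1 ∧ (∀ z, 1 ≤ ‖z‖ → ψ z = 0) ∧
    ∀ z, ∫ v, Complex.exp (-Complex.I * ((inner ℝ z v : ℝ) : ℂ)) * g v = ψ z := by
  have hp := Real.pi_pos
  let b : ContDiffBump (0 : EuclideanSpace ℝ (Fin N)) :=
    ⟨1 / (4 * Real.pi), 1 / (2 * Real.pi), by positivity, by gcongr; norm_num⟩
  let F : EuclideanSpace ℝ (Fin N) → ℂ := fun y => (b y : ℂ)
  have hF1 : HasCompactSupport F := b.hasCompactSupport.comp_left (g := fun x : ℝ => (x : ℂ)) (by simp)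
  have hF2 : ContDiff ℝ (⊤ : ℕ∞) F := Complex.ofRealCLM.contDiff.comp b.contDiff
  let S : 𝓢(EuclideanSpace ℝ (Fin N), ℂ) := hF1.toSchwartzMap hF2
  refine ⟨𝓕⁻ S, fun z => S ((2 * Real.pi)⁻¹ • z), ?_, ?_, ?_⟩
  · change ((b _ : ℝ) : ℂ) = 1
    rw [b.one_of_mem_closedBall]
    · simp
    · simp [b, hp.le]
  · intro z hz
    change ((b _ : ℝ) : ℂ) = 0
    rw [b.zero_of_le_dist]
    · simp
    · rw [dist_zero_right, norm_smul, Real.norm_of_nonneg (by positivity)]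
      change 1 / (2 * Real.pi) ≤ _
      rw [one_div]
      exact le_mul_of_one_le_right (by positivity) hz
  · intro z
    have h0 : 𝓕 (𝓕⁻ S : 𝓢(EuclideanSpace ℝ (Fin N), ℂ)) = S :=
      FourierTransform.fourier_fourierInv_eq S
    have h := congrArg (fun T : 𝓢(EuclideanSpace ℝ (Fin N), ℂ) => T ((2 * Real.pi)⁻¹ • z))
      h0
    beta_reduce at h
    rw [SchwartzMap.fourier_coe, Real.fourier_eq'] at h
    beta_reduce
    rw [← h]
    congr 1; ext v
    rw [smul_eq_mul]
    congr 2
    rw [inner_smul_right, real_inner_comm]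
    push_cast
    have : (Real.pi : ℂ) ≠ 0 := by exact_mod_cast hp.ne'
    field_simp

lemma integrable_Q (N : ℕ) (g : 𝓢(EuclideanSpace ℝ (Fin N), ℂ)) (β γ D : ℝ) (hβ : 0 < β)
    (hγ : 0 < γ) (hD : 0 < D) :
    Integrable (fun v : EuclideanSpace ℝ (Fin N) => ‖g v‖ ^ 2 * (‖v‖ ^ β * (‖v‖ + D) ^ γ)) := by
  obtain ⟨m, hm⟩ := exists_nat_gt (β + γ)
  obtain ⟨C, hC⟩ : ∃ C, ∀ v, ‖g v‖ ≤ C :=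
    ⟨_, fun v => SchwartzMap.norm_le_seminorm ℝ g v⟩
  have h1 : Integrable (fun v : EuclideanSpace ℝ (Fin N) => ‖v‖ ^ m * ‖g v‖) := g.integrable_pow_mul volume m
  have h2 : Integrable (fun v : EuclideanSpace ℝ (Fin N) => ‖g v‖) := g.integrable.norm
  have hg : Continuous g := g.continuous
  refine (((h1.add (h2.const_mul ((1 + D) ^ m))).const_mul (C * 2 ^ (m - 1)))).mono' ?_ ?_
  · apply Measurable.aestronglyMeasurable
    fun_prop
  · refine Filter.Eventually.of_forall fun v => ?_
    have hv := norm_nonneg v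
    rw [Real.norm_of_nonneg (by positivity)]
    simp only [Pi.add_apply]
    have hC0 : 0 ≤ C := (norm_nonneg _).trans (hC v)
    have hq : ‖v‖ ^ β * (‖v‖ + D) ^ γ ≤ 2 ^ (m - 1) * (‖v‖ ^ m + (1 + D) ^ m) := by
      calc ‖v‖ ^ β * (‖v‖ + D) ^ γ ≤ (‖v‖ + (1 + D)) ^ β * (‖v‖ + (1 + D)) ^ γ := by
            gcongr <;> linarith
        _ = (‖v‖ + (1 + D)) ^ (β + γ) := by rw [Real.rpow_add (by positivity)]
        _ ≤ (‖v‖ + (1 + D)) ^ (m : ℝ) := Real.rpow_le_rpow_of_exponent_le (by linarith) hm.le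
        _ = (‖v‖ + (1 + D)) ^ m := Real.rpow_natCast _ _
        _ ≤ _ := add_pow_le hv (by linarith) m
    calc ‖g v‖ ^ 2 * (‖v‖ ^ β * (‖v‖ + D) ^ γ) 
        = ‖g v‖ * ‖g v‖ * (‖v‖ ^ β * (‖v‖ + D) ^ γ)  := by ring
      _ ≤ C * ‖g v‖ * (2 ^ (m - 1) * (‖v‖ ^ m + (1 + D) ^ m)) := by
        gcongr; exact hC v
      _ = _ := by ring

lemma amgm_aux (A B a b q : ℝ) (hA : 0 < A) (hB : 0 < B) (hq : 0 < q) :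
    ENNReal.ofReal (a * b) ≤ ENNReal.ofReal (B / A / 2) * ENNReal.ofReal (a ^ 2 * q⁻¹) +
      ENNReal.ofReal (A / B / 2) * ENNReal.ofReal (b ^ 2 * q) := by
  rw [← ENNReal.ofReal_mul (by positivity), ← ENNReal.ofReal_mul (by positivity),
    ← ENNReal.ofReal_add (by positivity) (by positivity)]
  apply ENNReal.ofReal_le_ofReal
  have : B / A / 2 * (a ^ 2 * q⁻¹) + A / B / 2 * (b ^ 2 * q) - a * b =
      (B * a - A * q * b) ^ 2 / (2 * A * B * q) := by
    field_simp; ring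
  have h3 : 0 ≤ (B * a - A * q * b) ^ 2 / (2 * A * B * q) := by positivity
  linarith

noncomputable def Tt {N n : ℕ} (x : EuclideanSpace ℝ (Fin N)) (xs : Fin n → EuclideanSpace ℝ (Fin N))
    (coef : Fin n → ℝ) (ξ : EuclideanSpace ℝ (Fin N)) : ℂ :=
  Complex.exp (-Complex.I * ((inner ℝ x ξ : ℝ) : ℂ)) -
    ∑ j, (coef j : ℂ) * Complex.exp (-Complex.I * ((inner ℝ (xs j) ξ : ℝ) : ℂ))

lemma integral_Tt {N n : ℕ} (g : 𝓢(EuclideanSpace ℝ (Fin N), ℂ))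
    (ψ : EuclideanSpace ℝ (Fin N) → ℂ) (h0 : ψ 0 = 1) (h1 : ∀ z, 1 ≤ ‖z‖ → ψ z = 0)
    (h2 : ∀ z, ∫ v, Complex.exp (-Complex.I * ((inner ℝ z v : ℝ) : ℂ)) * g v = ψ z)
    (x : EuclideanSpace ℝ (Fin N)) (xs : Fin n → EuclideanSpace ℝ (Fin N))
    (coef : Fin n → ℝ) (ρ : ℝ) (hρ : 0 < ρ) (hx : ∀ j, ρ ≤ ‖x - xs j‖) :
    ∫ ξ, Tt x xs coef ξ * Complex.exp (Complex.I * ((inner ℝ x ξ : ℝ) : ℂ)) * g (ρ • ξ) =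
      (((ρ ^ N)⁻¹ : ℝ) : ℂ) := by
  have hint : ∀ z : EuclideanSpace ℝ (Fin N),
      Integrable (fun v => Complex.exp (-Complex.I * ((inner ℝ z v : ℝ) : ℂ)) * g v) := by
    intro z
    have hg := g.continuous
    refine g.integrable.mono (by fun_prop : Continuous _).aestronglyMeasurable
      (Filter.Eventually.of_forall fun v => ?_)
    rw [norm_mul, show -Complex.I * ((inner ℝ z v : ℝ) : ℂ) = ((-(inner ℝ z v) : ℝ) : ℂ) * Complex.I
      by push_cast; ring, Complex.norm_exp_ofReal_mul_I, one_mul]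
  let Φ : EuclideanSpace ℝ (Fin N) → ℂ := fun v =>
    Complex.exp (-Complex.I * ((inner ℝ (0 : EuclideanSpace ℝ (Fin N)) v : ℝ) : ℂ)) * g v -
    ∑ j, (coef j : ℂ) *
      (Complex.exp (-Complex.I * ((inner ℝ (ρ⁻¹ • (xs j - x)) v : ℝ) : ℂ)) * g v)
  have hΦ : ∫ v, Φ v = 1 := by
    simp only [Φ]
    rw [integral_sub (hint 0) (integrable_finsetSum _ fun j _ => (hint _).const_mul _),
      integral_finsetSum _ (fun j _ => (hint _).const_mul _), h2, h0]
    simp_rw [integral_const_mul, h2]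
    rw [Finset.sum_eq_zero, sub_zero]
    intro j _
    rw [h1, mul_zero]
    rw [norm_smul, norm_inv, Real.norm_of_nonneg hρ.le, norm_sub_rev, inv_mul_eq_div,
      le_div_iff₀ hρ, one_mul]
    exact hx j
  have hcomp : ∀ ξ, Tt x xs coef ξ * Complex.exp (Complex.I * ((inner ℝ x ξ : ℝ) : ℂ)) * g (ρ • ξ)
      = Φ (ρ • ξ) := by
    intro ξ
    simp only [Φ, Tt]
    rw [sub_mul, sub_mul, Finset.sum_mul, Finset.sum_mul]
    congr 1
    · rw [← Complex.exp_add]; simp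
    · refine Finset.sum_congr rfl fun j _ => ?_
      rw [← mul_assoc]
      congr 1
      rw [mul_assoc, ← Complex.exp_add]
      congr 2
      rw [inner_smul_left, inner_smul_right, inner_sub_left]
      have : (ρ : ℂ) ≠ 0 := by exact_mod_cast hρ.ne'
      simp only [conj_trivial]
      push_cast
      field_simp
      ring
  simp_rw [hcomp]
  rw [Measure.integral_comp_smul, hΦ, finrank_euclideanSpace_fin, abs_of_pos (by positivity)]
  simp

lemma LND_core (N : ℕ) (hN : 1 ≤ N) (β γ D M : ℝ) (hβ : 0 < β) (hγ : 0 < γ) (hD : 0 < D)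
    (hM : 0 < M) : ∃ C : ℝ, 0 < C ∧ ∀ (n : ℕ) (x : EuclideanSpace ℝ (Fin N))
      (xs : Fin n → EuclideanSpace ℝ (Fin N)) (coef : Fin n → ℝ) (ρ : ℝ), 0 < ρ → ρ ≤ 2 * M →
      (∀ j, ρ ≤ ‖x - xs j‖) →
      ENNReal.ofReal (C * ρ ^ (β + γ - N)) ≤
        ∫⁻ ξ, ENNReal.ofReal (‖Tt x xs coef ξ‖ ^ 2 * (‖ξ‖ ^ (-β) * (‖ξ‖ + D) ^ (-γ))) := by
  obtain ⟨g, ψ, h0, h1, h2⟩ := exists_bump N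
  have hgc : Continuous g := g.continuous
  have hD' : 0 < 2 * M * D := by positivity
  have hI := integrable_Q N g β γ (2 * M * D) hβ hγ hD'
  set Q0 : ℝ := (∫ v : EuclideanSpace ℝ (Fin N), ‖g v‖ ^ 2 * (‖v‖ ^ β * (‖v‖ + 2 * M * D) ^ γ)) + 1
    with hQ0
  have hQ0pos : 0 < Q0 := by
    have : 0 ≤ ∫ v : EuclideanSpace ℝ (Fin N), ‖g v‖ ^ 2 * (‖v‖ ^ β * (‖v‖ + 2 * M * D) ^ γ) :=
      integral_nonneg fun v => by
        have := norm_nonneg v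
        positivity
    linarith
  refine ⟨1 / Q0, by positivity, ?_⟩
  intro n x xs coef ρ hρ hρM hx
  set S := ∫⁻ ξ, ENNReal.ofReal (‖Tt x xs coef ξ‖ ^ 2 * (‖ξ‖ ^ (-β) * (‖ξ‖ + D) ^ (-γ))) with hS
  by_cases hStop : S = ⊤
  · rw [hStop]; exact le_top
  set A : ℝ := (ρ ^ N)⁻¹ with hA
  have hApos : 0 < A := by positivity
  set B : ℝ := ρ ^ (-(β + γ)) * (A * Q0) with hB
  have hBpos : 0 < B := by positivity
  have hTm : Measurable (Tt x xs coef) := by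
    unfold Tt; fun_prop
  -- the dual integral
  have hJ : ∫⁻ ξ, ENNReal.ofReal (‖g (ρ • ξ)‖ ^ 2 * (‖ξ‖ ^ β * (‖ξ‖ + D) ^ γ)) ≤
      ENNReal.ofReal B := by
    have hI2 := (hI.comp_smul hρ.ne').const_mul (ρ ^ (-(β + γ)))
    calc _ ≤ ∫⁻ ξ, ENNReal.ofReal (ρ ^ (-(β + γ)) *
          (‖g (ρ • ξ)‖ ^ 2 * (‖ρ • ξ‖ ^ β * (‖ρ • ξ‖ + 2 * M * D) ^ γ))) := by
          refine lintegral_mono fun ξ => ENNReal.ofReal_le_ofReal ?_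
          have hξ := norm_nonneg ξ
          rw [norm_smul, Real.norm_of_nonneg hρ.le]
          have e : (‖ξ‖ ^ β * (‖ξ‖ + D) ^ γ) =
              ρ ^ (-(β + γ)) * ((ρ * ‖ξ‖) ^ β * (ρ * ‖ξ‖ + ρ * D) ^ γ) := by
            rw [← mul_add, Real.mul_rpow hρ.le hξ, Real.mul_rpow hρ.le (by positivity),
              Real.rpow_neg hρ.le, Real.rpow_add hρ]
            have := Real.rpow_pos_of_pos hρ β
            have := Real.rpow_pos_of_pos hρ γ
            field_simp
          rw [e, mul_left_comm]
          gcongr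
      _ = ENNReal.ofReal (∫ ξ, (ρ ^ (-(β + γ)) *
          (‖g (ρ • ξ)‖ ^ 2 * (‖ρ • ξ‖ ^ β * (‖ρ • ξ‖ + 2 * M * D) ^ γ)))) := by
          rw [ofReal_integral_eq_lintegral_ofReal hI2]
          refine Filter.Eventually.of_forall fun ξ => ?_
          have := norm_nonneg (ρ • ξ)
          simp only [Pi.zero_apply]
          positivity
      _ ≤ _ := by
          apply ENNReal.ofReal_le_ofReal
          rw [integral_const_mul, Measure.integral_comp_smul volume
            (fun v => ‖g v‖ ^ 2 * (‖v‖ ^ β * (‖v‖ + 2 * M * D) ^ γ)), finrank_euclideanSpace_fin,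
            abs_of_pos (by positivity), smul_eq_mul, hB]
          gcongr
          linarith
  clear_value B A S Q0
  have hmain : ENNReal.ofReal A ≤ ENNReal.ofReal (B / A / 2) * S +
      ENNReal.ofReal (A / B / 2) * ENNReal.ofReal B := by
    have e := integral_Tt g ψ h0 h1 h2 x xs coef ρ hρ hx
    rw [← hA] at e
    calc ENNReal.ofReal A = ‖((A : ℝ) : ℂ)‖ₑ := by
          rw [← ofReal_norm, Complex.norm_real, Real.norm_of_nonneg hApos.le]
      _ = ‖∫ ξ, Tt x xs coef ξ * Complex.exp (Complex.I * ((inner ℝ x ξ : ℝ) : ℂ)) * g (ρ • ξ)‖ₑ := by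
          rw [e]
      _ ≤ ∫⁻ ξ, ‖Tt x xs coef ξ * Complex.exp (Complex.I * ((inner ℝ x ξ : ℝ) : ℂ)) * g (ρ • ξ)‖ₑ :=
          enorm_integral_le_lintegral_enorm _
      _ ≤ ∫⁻ ξ, (ENNReal.ofReal (B / A / 2) *
            ENNReal.ofReal (‖Tt x xs coef ξ‖ ^ 2 * (‖ξ‖ ^ (-β) * (‖ξ‖ + D) ^ (-γ))) +
          ENNReal.ofReal (A / B / 2) *
            ENNReal.ofReal (‖g (ρ • ξ)‖ ^ 2 * (‖ξ‖ ^ β * (‖ξ‖ + D) ^ γ))) := by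
          have : Nonempty (Fin N) := ⟨⟨0, hN⟩⟩
          have : Nontrivial (EuclideanSpace ℝ (Fin N)) := inferInstance
          have hae : ∀ᵐ ξ : EuclideanSpace ℝ (Fin N), ξ ≠ 0 := by
            rw [ae_iff]; simp
          refine lintegral_mono_ae ?_
          filter_upwards [hae] with ξ hξ
          have hr : 0 < ‖ξ‖ := norm_pos_iff.2 hξ
          have hq : 0 < ‖ξ‖ ^ β * (‖ξ‖ + D) ^ γ := by positivity
          rw [← ofReal_norm, norm_mul, norm_mul, mul_comm Complex.I, Complex.norm_exp_ofReal_mul_I,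
            mul_one, Real.rpow_neg hr.le, Real.rpow_neg (by positivity), ← mul_inv]
          exact amgm_aux A B _ _ _ hApos hBpos hq
      _ = ENNReal.ofReal (B / A / 2) * S + ENNReal.ofReal (A / B / 2) *
            ∫⁻ ξ, ENNReal.ofReal (‖g (ρ • ξ)‖ ^ 2 * (‖ξ‖ ^ β * (‖ξ‖ + D) ^ γ)) := by
          rw [lintegral_add_left (by fun_prop), lintegral_const_mul _ (by fun_prop),
            lintegral_const_mul _ (by fun_prop), hS]
      _ ≤ _ := by gcongr
  rw [← ENNReal.ofReal_toReal hStop] at hmain ⊢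
  rw [← ENNReal.ofReal_mul (by positivity), ← ENNReal.ofReal_mul (by positivity),
    ← ENNReal.ofReal_add (by positivity) (by positivity),
    ENNReal.ofReal_le_ofReal_iff (by positivity)] at hmain
  apply ENNReal.ofReal_le_ofReal
  generalize S.toReal = s at hmain
  have h4 : A ^ 2 / B ≤ s := by
    have : A / B / 2 * B = A / 2 := by field_simp
    rw [this] at hmain
    have h5 : A / 2 ≤ B / A / 2 * s := by linarith
    rw [div_le_iff₀ hBpos]
    have h6 : B / A / 2 * s = B * s / A / 2 := by ring
    rw [h6] at h5
    have h7 : A ≤ B * s / A := by linarith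
    rw [le_div_iff₀ hApos] at h7
    linarith
  refine le_trans (le_of_eq ?_) h4
  rw [hB, Real.rpow_sub hρ, Real.rpow_neg hρ.le, hA, Real.rpow_natCast]
  have := Real.rpow_pos_of_pos hρ (β + γ)
  field_simp

lemma Gker_eq (N : ℕ) (t : ℝ) (x : EuclideanSpace ℝ (Fin N)) (τ : ℝ)
    (ξ : EuclideanSpace ℝ (Fin N)) : Gker N t x τ ξ =
    (Complex.exp (-Complex.I * ((inner ℝ x ξ : ℝ) : ℂ)) / (2 * (‖ξ‖ : ℂ))) * Kk t ‖ξ‖ τ := rfl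

lemma comb_eq {N n : ℕ} (t : ℝ) (x : EuclideanSpace ℝ (Fin N))
    (xs : Fin n → EuclideanSpace ℝ (Fin N)) (coef : Fin n → ℝ) (τ : ℝ)
    (ξ : EuclideanSpace ℝ (Fin N)) :
    Gker N t x τ ξ - ∑ j, (coef j : ℂ) * Gker N t (xs j) τ ξ =
      Tt x xs coef ξ * (Kk t ‖ξ‖ τ / (2 * (‖ξ‖ : ℂ))) := by
  simp only [Gker_eq, Tt, sub_mul, Finset.sum_mul]
  congr 1
  · ring
  · exact Finset.sum_congr rfl fun j _ => by ring

lemma point_lower (H β c₁ t r τ a h : ℝ) (hH1 : 1 / 2 ≤ H) (hc₁ : 0 < c₁) (ht : 0 < t) (hr : 0 < r)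
    (hh : c₁ * r ^ (-β) ≤ h) (h1 : r < τ) (h2 : τ < r + 1 / (12 * t)) (ha : 0 ≤ a) :
    (t ^ 2 / 144 * c₁) * (a ^ 2 * (r ^ (-β) * (r + 1 / t) ^ (-(1 + 2 * H)))) ≤
      (a * (‖Kk t r τ‖ / (2 * r))) ^ 2 * |τ| ^ (1 - 2 * H) * h := by
  have hK := Kk_lower t r τ ht hr h1 h2
  have hD : 0 < r + 1 / t := by positivity
  have hm : r / (r + 1 / t) ≤ min 1 (t * r) := by
    rw [le_min_iff]
    constructor
    · rw [div_le_one hD]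
      have : 0 < 1 / t := by positivity
      linarith
    · rw [div_le_iff₀ hD]
      have : t * r * (r + 1 / t) = t * r * r + r := by field_simp
      rw [this]
      have : 0 < t * r * r := by positivity
      linarith
  have hK2 : t / 12 * (1 / (r + 1 / t)) ≤ ‖Kk t r τ‖ / (2 * r) := by
    rw [le_div_iff₀ (by positivity)]
    calc t / 12 * (1 / (r + 1 / t)) * (2 * r) = t / 6 * (r / (r + 1 / t)) := by ring
      _ ≤ t / 6 * min 1 (t * r) := by gcongr
      _ ≤ _ := hK
  have hτ : (r + 1 / t) ^ (1 - 2 * H) ≤ |τ| ^ (1 - 2 * H) := by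
    rw [abs_of_pos (by linarith)]
    apply Real.rpow_le_rpow_of_nonpos (by linarith) _ (by linarith)
    have : 1 / (12 * t) ≤ 1 / t := by
      apply one_div_le_one_div_of_le ht; linarith
    linarith
  have e : (r + 1 / t) ^ (-(1 + 2 * H)) = (1 / (r + 1 / t)) ^ 2 * (r + 1 / t) ^ (1 - 2 * H) := by
    rw [show -(1 + 2 * H) = (-2 : ℝ) + (1 - 2 * H) by ring, Real.rpow_add hD]
    congr 1
    rw [Real.rpow_neg hD.le]
    simp
  rw [e]
  calc _ = (a * (t / 12 * (1 / (r + 1 / t)))) ^ 2 * (r + 1 / t) ^ (1 - 2 * H) * (c₁ * r ^ (-β)) := by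
        ring
    _ ≤ _ := by gcongr

lemma specInt_lower {N n : ℕ} (hN : 1 ≤ N) (H β : ℝ) (hH1 : 1 / 2 ≤ H)
    (hfun : EuclideanSpace ℝ (Fin N) → ℝ) (hmeas : Measurable hfun)
    (c₁ : ℝ) (hc₁ : 0 < c₁)
    (hflow : ∀ ξ : EuclideanSpace ℝ (Fin N), ξ ≠ 0 → c₁ * ‖ξ‖ ^ (-β) ≤ hfun ξ)
    (t : ℝ) (ht : 0 < t) (x : EuclideanSpace ℝ (Fin N))
    (xs : Fin n → EuclideanSpace ℝ (Fin N)) (coef : Fin n → ℝ) :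
    ENNReal.ofReal (1 / (12 * t) * (t ^ 2 / 144 * c₁)) *
      ∫⁻ ξ, ENNReal.ofReal (‖Tt x xs coef ξ‖ ^ 2 *
        (‖ξ‖ ^ (-β) * (‖ξ‖ + 1 / t) ^ (-(1 + 2 * H)))) ≤
    specInt N H hfun
      (fun τ ξ => Gker N t x τ ξ - ∑ j, (coef j : ℂ) * Gker N t (xs j) τ ξ) := by
  have hTm : Measurable (Tt x xs coef) := by
    unfold Tt; fun_prop
  unfold specInt
  simp_rw [comb_eq]
  rw [lintegral_lintegral_swap]
  · rw [← lintegral_const_mul _ (by fun_prop)]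
    have : Nonempty (Fin N) := ⟨⟨0, hN⟩⟩
    have : Nontrivial (EuclideanSpace ℝ (Fin N)) := inferInstance
    have hae : ∀ᵐ ξ : EuclideanSpace ℝ (Fin N), ξ ≠ 0 := by
      rw [ae_iff]; simp
    refine lintegral_mono_ae ?_
    filter_upwards [hae] with ξ hξ
    have hr : 0 < ‖ξ‖ := norm_pos_iff.2 hξ
    refine le_trans ?_ (setLIntegral_le_lintegral (Ioo ‖ξ‖ (‖ξ‖ + 1 / (12 * t))) _)
    have hvol : volume (Ioo ‖ξ‖ (‖ξ‖ + 1 / (12 * t))) = ENNReal.ofReal (1 / (12 * t)) := by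
      rw [Real.volume_Ioo, add_sub_cancel_left]
    calc _ = ∫⁻ τ in Ioo ‖ξ‖ (‖ξ‖ + 1 / (12 * t)), ENNReal.ofReal ((t ^ 2 / 144 * c₁) *
          (‖Tt x xs coef ξ‖ ^ 2 * (‖ξ‖ ^ (-β) * (‖ξ‖ + 1 / t) ^ (-(1 + 2 * H))))) := by
          rw [setLIntegral_const, hvol, ENNReal.ofReal_mul (by positivity),
            ENNReal.ofReal_mul (p := t ^ 2 / 144 * c₁) (by positivity)]
          ring
      _ ≤ _ := by
          refine setLIntegral_mono' measurableSet_Ioo fun τ hτ => ENNReal.ofReal_le_ofReal ?_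
          have := point_lower H β c₁ t ‖ξ‖ τ ‖Tt x xs coef ξ‖ (hfun ξ) hH1 hc₁ ht hr
            (hflow ξ hξ) hτ.1 hτ.2 (norm_nonneg _)
          refine this.trans (le_of_eq ?_)
          rw [norm_mul, norm_div, norm_mul, Complex.norm_real, norm_norm]
          simp
  · apply Measurable.aemeasurable
    unfold Function.uncurry Kk
    fun_prop

/-- Proposition 3.5: `x ↦ u₁(t₀, x)` is stationary with spectral density
`N_{t₀}(ξ) h_β(ξ)`, and satisfies strong local nondeterminism in the space variable.
Here `2α = 2H + 1 − N + β`. -/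
theorem strong_LND_space_variable
    (N : ℕ) (hN : 1 ≤ N) (H β : ℝ) (hH1 : 1 / 2 ≤ H) (hH2 : H < 1)
    (hβ0 : 0 < β) (hβN : β < N)
    (hβlow : (N : ℝ) - 2 * H - 1 < β) (hβup : β < (N : ℝ) - 2 * H + 1)
    (hfun : EuclideanSpace ℝ (Fin N) → ℝ) (hmeas : Measurable hfun)
    (c₁ c₂ : ℝ) (hc₁ : 0 < c₁) (hc₁₂ : c₁ ≤ c₂)
    (hflow : ∀ ξ : EuclideanSpace ℝ (Fin N), ξ ≠ 0 → c₁ * ‖ξ‖ ^ (-β) ≤ hfun ξ)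
    (hfup : ∀ ξ : EuclideanSpace ℝ (Fin N), ξ ≠ 0 → hfun ξ ≤ c₂ * ‖ξ‖ ^ (-β))
    (t₀ : ℝ) (ht₀ : 0 < t₀) :
    (∀ (x y ξ : EuclideanSpace ℝ (Fin N)), ξ ≠ 0 →
        ∫ τ : ℝ,
            Gker N t₀ x τ ξ * (starRingEnd ℂ) (Gker N t₀ y τ ξ) *
              ((|τ| ^ (1 - 2 * H) : ℝ) : ℂ) =
          Complex.exp (-Complex.I * ((inner ℝ (x - y) ξ : ℝ) : ℂ)) * (Ndens H t₀ ‖ξ‖ : ℂ)) ∧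
      ∀ M : ℝ, 0 < M →
        ∃ C : ℝ, 0 < C ∧
          ∀ n : ℕ, 1 ≤ n →
            ∀ (x : EuclideanSpace ℝ (Fin N)) (xs : Fin n → EuclideanSpace ℝ (Fin N)),
              ‖x‖ ≤ M → (∀ j, ‖xs j‖ ≤ M) →
              ∀ coef : Fin n → ℝ,
                ENNReal.ofReal (C * ⨅ j, ‖x - xs j‖ ^ (2 * H + 1 - N + β)) ≤
                  specInt N H hfun
                    (fun τ ξ =>
                      Gker N t₀ x τ ξ - ∑ j, (coef j : ℂ) * Gker N t₀ (xs j) τ ξ) := by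
  refine ⟨?_, ?_⟩
  · intro x y ξ hξ
    have hr : (‖ξ‖ : ℂ) ≠ 0 := by exact_mod_cast (norm_pos_iff.2 hξ).ne'
    have e : ∀ τ : ℝ, Gker N t₀ x τ ξ * (starRingEnd ℂ) (Gker N t₀ y τ ξ) *
              ((|τ| ^ (1 - 2 * H) : ℝ) : ℂ) =
        (Complex.exp (-Complex.I * ((inner ℝ (x - y) ξ : ℝ) : ℂ)) * ((1 / (4 * ‖ξ‖ ^ 2) : ℝ) : ℂ)) *
          ((‖Kk t₀ ‖ξ‖ τ‖ ^ 2 * |τ| ^ (1 - 2 * H) : ℝ) : ℂ) := by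
      intro τ
      rw [Gker_eq, Gker_eq, map_mul, map_div₀, ← Complex.exp_conj]
      have h1 : Complex.exp (-Complex.I * ((inner ℝ (x - y) ξ : ℝ) : ℂ)) =
          Complex.exp (-Complex.I * ((inner ℝ x ξ : ℝ) : ℂ)) *
          Complex.exp ((starRingEnd ℂ) (-Complex.I * ((inner ℝ y ξ : ℝ) : ℂ))) := by
        rw [← Complex.exp_add, inner_sub_left]
        congr 1
        simp
        ring
      have h2 := Complex.mul_conj' (Kk t₀ ‖ξ‖ τ)
      rw [h1]
      push_cast
      rw [← h2]
      simp only [map_mul, Complex.conj_ofReal, map_ofNat]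
      field_simp
      ring
    simp_rw [e]
    rw [integral_const_mul, integral_complex_ofReal, mul_assoc, ← Complex.ofReal_mul]
    rfl
  · intro M hM
    obtain ⟨C, hC, hcore⟩ := LND_core N hN β (1 + 2 * H) (1 / t₀) M hβ0 (by linarith)
      (by positivity) hM
    refine ⟨1 / (12 * t₀) * (t₀ ^ 2 / 144 * c₁) * C, by positivity, ?_⟩
    intro n hn x xs hx hxs coef
    have : Nonempty (Fin n) := ⟨⟨0, hn⟩⟩
    obtain ⟨j₀, hj₀⟩ := Finite.exists_min (fun j => ‖x - xs j‖)
    have hle : ⨅ j, ‖x - xs j‖ ^ (2 * H + 1 - N + β) ≤ ‖x - xs j₀‖ ^ (2 * H + 1 - N + β) :=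
      ciInf_le (Set.finite_range _).bddBelow j₀
    have hlow := specInt_lower hN H β hH1 hfun hmeas c₁ hc₁ hflow t₀ ht₀ x xs coef
    refine le_trans ?_ hlow
    refine le_trans (ENNReal.ofReal_le_ofReal (mul_le_mul_of_nonneg_left hle (by positivity))) ?_
    rcases (norm_nonneg (x - xs j₀)).eq_or_lt with h0 | h0
    · rw [← h0, Real.zero_rpow (by linarith)]
      simp
    · rw [mul_assoc _ C, ENNReal.ofReal_mul (by positivity)]
      gcongr
      have := hcore n x xs coef ‖x - xs j₀‖ h0
        ((norm_sub_le _ _).trans (by linarith [hxs j₀])) hj₀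
      rw [show β + (1 + 2 * H) - N = 2 * H + 1 - N + β by ring] at this
      exact this
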